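/- Let ϕ : S → ℓᵖ be a disintegration (1 ≤ p < ∞), let ε(ν) = min{‖ϕ(ν)‖ₚᵖ, 2^{−|ν|}}, and let C ⊆ S be a chain such that whenever ν ∈ C is nonterminal, C contains a child ν′ of ν with max_μ ‖ϕ(μ)‖ₚᵖ − ‖ϕ(ν′)‖ₚᵖ < ε(ν). Let f be a unit atom. If some ν ∈ C satisfies ‖ϕ(ν) − f*(ϕ(ν))f‖ₚᵖ + ε(ν) < ‖f*(ϕ(ν))f‖ₚᵖ, then inf ϕ[C] = f*(ϕ(ν))·f. -/

import Mathlib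

open scoped ENNReal
open Filter

noncomputable section

abbrev ellp (p : ℝ≥0∞) := lp (fun _ : ℕ => ℂ) p

/-- the standard basis vector `e n` -/
noncomputable def stdb (p : ℝ≥0∞) (n : ℕ) : ellp p := lp.single p n 1

/-- `f` and `g` are disjointly supported -/
def DisjSupp {p : ℝ≥0∞} (f g : ellp p) : Prop := ∀ n : ℕ, f n = 0 ∨ g n = 0

/-- the subvector relation: `f = g · χ_A` for some `A ⊆ ℕ` -/
def Subvec {p : ℝ≥0∞} (f g : ellp p) : Prop :=
  ∃ A : Set ℕ, ⇑f = A.indicator ⇑g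

/-- a tree is a prefix-closed set of finite sequences of naturals -/
def IsTree (S : Set (List ℕ)) : Prop := ∀ ν ∈ S, ∀ ν' : List ℕ, ν' <+: ν → ν' ∈ S

/-- `ν'` is a child of `ν` in `S` -/
def ChildIn (S : Set (List ℕ)) (ν ν' : List ℕ) : Prop :=
  ν' ∈ S ∧ ∃ m : ℕ, ν' = ν ++ [m]

/-- `ν` is a nonterminal node of `S` -/
def Nonterminal (S : Set (List ℕ)) (ν : List ℕ) : Prop := ∃ ν', ChildIn S ν ν'

/-- a disintegration of `ℓᵖ`: injective, never zero, separating, summative, with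
linearly dense range -/
structure Disintegration (p : ℝ≥0∞) [Fact (1 ≤ p)] (S : Set (List ℕ)) (φ : List ℕ → ellp p) : Prop where
  tree : IsTree S
  inj : Set.InjOn φ S
  nonzero : ∀ ν ∈ S, φ ν ≠ 0
  separating : ∀ ν ∈ S, ∀ ν' ∈ S, ¬ν <+: ν' → ¬ν' <+: ν → DisjSupp (φ ν) (φ ν')
  summative : ∀ ν ∈ S, Nonterminal S ν →
    HasSum (fun μ : {μ : List ℕ // ChildIn S ν μ} => φ μ.val) (φ ν)
  dense : Dense (Submodule.span ℂ (φ '' S) : Set (ellp p))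

/-- a chain with respect to the prefix (ancestor) order -/
def PrefixChain (C : Set (List ℕ)) : Prop := ∀ ν ∈ C, ∀ ν' ∈ C, ν <+: ν' ∨ ν' <+: ν

/-- an almost norm-maximizing chain -/
def ANMChain (p : ℝ≥0∞) (S : Set (List ℕ)) (φ : List ℕ → ellp p)
    (C : Set (List ℕ)) : Prop :=
  C ⊆ S ∧ PrefixChain C ∧ ∀ ν ∈ C, Nonterminal S ν →
    ∃ ν', ν' ∈ C ∧ ChildIn S ν ν' ∧ ∀ μ, ChildIn S ν μ →
      ‖φ μ‖ ^ p.toReal ≤ ‖φ ν'‖ ^ p.toReal + 2 ^ (-(ν.length : ℤ))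

/-- `g` is the greatest lower bound of `A` in the subvector order -/
def IsSubvecGLB {p : ℝ≥0∞} (g : ellp p) (A : Set (ellp p)) : Prop :=
  (∀ h ∈ A, Subvec g h) ∧ ∀ g', (∀ h ∈ A, Subvec g' h) → Subvec g' g
/-- the functional `f*` induced by `f`. -/
noncomputable def star' {p : ℝ≥0∞} (f g : ellp p) : ℂ :=
  ∑' n : ℕ, g n * starRingEnd ℂ (f n)

/-- the error term `ε(ν) = min{‖φ(ν)‖ₚᵖ, 2^{-|ν|}}` -/
noncomputable def eps (p : ℝ≥0∞) (φ : List ℕ → ellp p) (ν : List ℕ) : ℝ :=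
  min (‖φ ν‖ ^ p.toReal) (2 ^ (-(ν.length : ℤ)))

/-- a chain satisfying the strict almost norm-maximizing condition with error `ε(ν)` -/
def StrictANMChain (p : ℝ≥0∞) (S : Set (List ℕ)) (φ : List ℕ → ellp p)
    (C : Set (List ℕ)) : Prop :=
  C ⊆ S ∧ PrefixChain C ∧ ∀ ν ∈ C, Nonterminal S ν →
    ∃ ν', ν' ∈ C ∧ ChildIn S ν ν' ∧ ∀ μ, ChildIn S ν μ →
      ‖φ μ‖ ^ p.toReal - ‖φ ν'‖ ^ p.toReal < eps p φ ν


theorem sib_disj {p : ℝ≥0∞} [Fact (1 ≤ p)] {S : Set (List ℕ)} {φ : List ℕ → ellp p}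
    (hφ : Disintegration p S φ) {ν μ μ' : List ℕ} (h : ChildIn S ν μ) (h' : ChildIn S ν μ')
    (hne : μ ≠ μ') : DisjSupp (φ μ) (φ μ') := by
  obtain ⟨hS, m, rfl⟩ := h
  obtain ⟨hS', m', rfl⟩ := h'
  apply hφ.separating _ hS _ hS'
  · intro hp
    exact hne (hp.eq_of_length (by simp))
  · intro hp
    exact hne (hp.eq_of_length (by simp)).symm

theorem hasSum_eval {p : ℝ≥0∞} [Fact (1 ≤ p)] {S : Set (List ℕ)} {φ : List ℕ → ellp p}
    (hφ : Disintegration p S φ) {ν : List ℕ} (hν : ν ∈ S) (hn : Nonterminal S ν) (m : ℕ) :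
    HasSum (fun μ : {μ : List ℕ // ChildIn S ν μ} => φ μ.val m) (φ ν m) :=
  (hφ.summative ν hν hn).mapL (lp.evalCLM ℂ (fun _ : ℕ => ℂ) p m)

theorem child_eval {p : ℝ≥0∞} [Fact (1 ≤ p)] {S : Set (List ℕ)} {φ : List ℕ → ellp p}
    (hφ : Disintegration p S φ) {ν μ : List ℕ} (hν : ν ∈ S) (h : ChildIn S ν μ) (m : ℕ)
    (hm : φ μ m ≠ 0) : φ ν m = φ μ m := by
  have h1 := hasSum_eval hφ hν ⟨μ, h⟩ m
  have h2 := hasSum_single (f := fun μ : {μ : List ℕ // ChildIn S ν μ} => φ μ.val m) ⟨μ, h⟩ (by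
    rintro ⟨μ', h'⟩ hne
    have := sib_disj hφ h h' (fun e => hne (by simp [e])) m
    tauto)
  exact h1.unique h2

theorem exists_child {p : ℝ≥0∞} [Fact (1 ≤ p)] {S : Set (List ℕ)} {φ : List ℕ → ellp p}
    (hφ : Disintegration p S φ) {ν : List ℕ} (hν : ν ∈ S) (hn : Nonterminal S ν) (m : ℕ)
    (hm : φ ν m ≠ 0) : ∃ μ, ChildIn S ν μ ∧ φ μ m = φ ν m := by
  by_contra hcon
  push Not at hcon
  have h1 := hasSum_eval hφ hν hn m
  have h0 : (fun μ : {μ : List ℕ // ChildIn S ν μ} => φ μ.val m) = fun _ => 0 := by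
    funext μ
    by_contra h
    exact hcon μ.1 μ.2 (child_eval hφ hν μ.2 m h).symm
  rw [h0] at h1
  exact hm (h1.unique hasSum_zero)

theorem desc_eval {p : ℝ≥0∞} [Fact (1 ≤ p)] {S : Set (List ℕ)} {φ : List ℕ → ellp p}
    (hφ : Disintegration p S φ) (m : ℕ) (ν t : List ℕ) : ν ++ t ∈ S → φ (ν ++ t) m ≠ 0 →
    φ ν m = φ (ν ++ t) m := by
  induction t using List.reverseRecOn with
  | nil => simp
  | append_singleton t a ih =>
    intro hS h0
    have hS' : ν ++ t ∈ S := hφ.tree _ hS _ ⟨[a], by simp⟩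
    have := child_eval hφ hS' (μ := ν ++ (t ++ [a])) ⟨hS, a, by simp⟩ m h0
    rw [← this] at h0 ⊢
    exact ih hS' h0

theorem anc_eval {p : ℝ≥0∞} [Fact (1 ≤ p)] {S : Set (List ℕ)} {φ : List ℕ → ellp p}
    (hφ : Disintegration p S φ) (m : ℕ) {ν μ : List ℕ} (h : ν <+: μ) (hS : μ ∈ S)
    (h0 : φ μ m ≠ 0) : φ ν m = φ μ m := by
  obtain ⟨t, rfl⟩ := h
  exact desc_eval hφ m ν t hS h0

theorem next_child {S C : Set (List ℕ)} (hS : IsTree S) (hCS : C ⊆ S) {σ τ : List ℕ}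
    (hτ : τ ∈ S) (h : σ <+: τ) (hlt : σ.length < τ.length) : Nonterminal S σ := by
  obtain ⟨t, rfl⟩ := h
  cases t with
  | nil => simp at hlt
  | cons a t => exact ⟨σ ++ [a], hS _ hτ _ ⟨t, by simp⟩, a, rfl⟩

theorem key_step {p : ℝ≥0∞} [Fact (1 ≤ p)] (hptop : p ≠ ∞)
    {S : Set (List ℕ)} {φ : List ℕ → ellp p} (hφ : Disintegration p S φ)
    {C : Set (List ℕ)} (hC : StrictANMChain p S φ C) (v : ellp p) (n : ℕ)
    (hv : ∀ m, m ≠ n → v m = 0) (hvn : v n ≠ 0) (k : ℕ) :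
    ∀ σ ∈ C, φ σ n = v n → ‖φ σ - v‖ ^ p.toReal + eps p φ σ < ‖v‖ ^ p.toReal →
      ∀ τ ∈ C, σ <+: τ → τ.length = σ.length + k → φ τ n = v n := by
  have hp0 : p ≠ 0 := (zero_lt_one.trans_le (Fact.out : 1 ≤ p)).ne'
  have hpr : 0 ≤ p.toReal := ENNReal.toReal_nonneg
  induction k with
  | zero =>
    intro σ hσ h1 h2 τ hτ hp hl
    rw [← hp.eq_of_length (by omega)]
    exact h1
  | succ k ih =>
    intro σ hσ h1 h2 τ hτ hp hl
    have hσS := hC.1 hσ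
    have hnt := next_child hφ.tree hC.1 (hC.1 hτ) hp (by omega)
    obtain ⟨σ', hσ', hch, hmax⟩ := hC.2.2 σ hσ hnt
    have hlen : σ'.length = σ.length + 1 := by
      obtain ⟨_, m, rfl⟩ := hch
      simp
    have hp' : σ' <+: τ := by
      rcases hC.2.1 σ' hσ' τ hτ with h | h
      · exact h
      · have : τ.length ≤ σ'.length := h.length_le
        rw [h.eq_of_length (by omega)]
    have hsub : ∀ m, φ σ' m = 0 ∨ φ σ' m = φ σ m := fun m => by
      by_cases h : φ σ' m = 0
      · exact Or.inl h
      · exact Or.inr (child_eval hφ hσS hch m h).symm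
    have h1' : φ σ' n = v n := by
      by_contra hne
      have h0 : φ σ' n = 0 := by
        rcases hsub n with h | h
        · exact h
        · exact absurd (h.trans h1) hne
      obtain ⟨μ, hμ, hμn⟩ := exists_child hφ hσS hnt n (by rw [h1]; exact hvn)
      have hA : ‖φ σ'‖ ≤ ‖φ σ - v‖ := by
        apply lp.norm_mono hp0
        intro m
        rw [lp.coeFn_sub, Pi.sub_apply]
        by_cases hm : m = n
        · subst hm; simp [h0]
        · rw [hv m hm, sub_zero]
          rcases hsub m with h | h <;> simp [h]
      have hB : ‖v‖ ≤ ‖φ μ‖ := by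
        apply lp.norm_mono hp0
        intro m
        by_cases hm : m = n
        · subst hm; rw [hμn, h1]
        · rw [hv m hm]; simp
      have hA' := Real.rpow_le_rpow (norm_nonneg _) hA hpr
      have hB' := Real.rpow_le_rpow (norm_nonneg _) hB hpr
      have := hmax μ hμ
      linarith
    refine ih σ' hσ' h1' ?_ τ hτ hp' (by omega)
    have hA : ‖φ σ' - v‖ ≤ ‖φ σ - v‖ := by
      apply lp.norm_mono hp0
      intro m
      rw [lp.coeFn_sub, Pi.sub_apply, lp.coeFn_sub, Pi.sub_apply]
      by_cases hm : m = n
      · subst hm; simp [h1, h1']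
      · rw [hv m hm, sub_zero, sub_zero]
        rcases hsub m with h | h <;> simp [h]
    have hB : ‖φ σ'‖ ≤ ‖φ σ‖ := by
      apply lp.norm_mono hp0
      intro m
      rcases hsub m with h | h <;> simp [h]
    have hA' := Real.rpow_le_rpow (norm_nonneg _) hA hpr
    have hB' := Real.rpow_le_rpow (norm_nonneg _) hB hpr
    have hE : eps p φ σ' ≤ eps p φ σ := by
      unfold eps
      apply min_le_min hB'
      apply zpow_le_zpow_right₀ (by norm_num)
      omega
    linarith

theorem no_two {p : ℝ≥0∞} [Fact (1 ≤ p)]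
    {S : Set (List ℕ)} {φ : List ℕ → ellp p} (hφ : Disintegration p S φ)
    {C : Set (List ℕ)} (hC : StrictANMChain p S φ C) (hne : C.Nonempty) (m n : ℕ) (hmn : m ≠ n)
    (a b : ℂ) (ha : a ≠ 0) (hb : b ≠ 0)
    (hn : ∀ σ ∈ C, φ σ n = a) (hm : ∀ σ ∈ C, φ σ m = b) : False := by
  let L : ellp p →L[ℂ] ℂ := b • lp.evalCLM ℂ (fun _ : ℕ => ℂ) p n
    - a • lp.evalCLM ℂ (fun _ : ℕ => ℂ) p m
  have hL : ∀ g, L g = b * g n - a * g m := fun g => rfl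
  have hS : ∀ σ ∈ S, L (φ σ) = 0 := by
    intro σ hσ
    rw [hL]
    by_cases h1 : ∃ μ ∈ C, σ <+: μ
    · obtain ⟨μ, hμ, hp⟩ := h1
      rw [anc_eval hφ n hp (hC.1 hμ) (by rw [hn μ hμ]; exact ha),
        anc_eval hφ m hp (hC.1 hμ) (by rw [hm μ hμ]; exact hb), hn μ hμ, hm μ hμ]
      ring
    by_cases h2 : ∃ μ ∈ C, ¬ μ <+: σ
    · obtain ⟨μ, hμ, hp⟩ := h2
      have hd := hφ.separating σ hσ μ (hC.1 hμ) (fun h => h1 ⟨μ, hμ, h⟩) hp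
      have d1 : φ σ n = 0 := (hd n).resolve_right (by rw [hn μ hμ]; exact ha)
      have d2 : φ σ m = 0 := (hd m).resolve_right (by rw [hm μ hμ]; exact hb)
      simp [d1, d2]
    exfalso
    push Not at h1 h2
    have hk : ∀ k, ∃ μ ∈ C, k ≤ μ.length := by
      intro k
      induction k with
      | zero => obtain ⟨μ, hμ⟩ := hne; exact ⟨μ, hμ, by simp⟩
      | succ k ih =>
        obtain ⟨μ, hμ, hl⟩ := ih
        have hp := h2 μ hμ
        have hlt : μ.length < σ.length := by
          rcases hp.length_le.lt_or_eq with h | h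
          · exact h
          · exact absurd (hp.eq_of_length h ▸ List.prefix_rfl) (h1 μ hμ)
        obtain ⟨μ', hμ', ⟨_, c, rfl⟩, _⟩ := hC.2.2 μ hμ (next_child hφ.tree hC.1 hσ hp hlt)
        exact ⟨_, hμ', by simp; omega⟩
    obtain ⟨μ, hμ, hl⟩ := hk (σ.length + 1)
    have := (h2 μ hμ).length_le
    omega
  have hL0 : L = 0 := by
    refine ContinuousLinearMap.ext_on hφ.dense ?_
    rintro _ ⟨σ, hσ, rfl⟩
    simpa using hS σ hσ
  have := hL (lp.single p n 1)
  rw [hL0, lp.single_apply_self, lp.single_apply_ne _ _ _ hmn] at this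
  simp at this
  exact hb this.symm

/-- if some `ν ∈ C` satisfies the recognition inequality
`‖φ(ν) − f*(φ(ν))f‖ₚᵖ + ε(ν) < ‖f*(φ(ν))f‖ₚᵖ`, then `inf φ[C] = f*(φ(ν))·f`. -/
theorem stmt_12 (p : ℝ≥0∞) [Fact (1 ≤ p)] (hptop : p ≠ ∞)
    (S : Set (List ℕ)) (φ : List ℕ → ellp p) (hφ : Disintegration p S φ)
    (C : Set (List ℕ)) (hC : StrictANMChain p S φ C)
    (f : ellp p) (hfnorm : ‖f‖ = 1) (hfatom : ∃ n : ℕ, {m : ℕ | f m ≠ 0} = {n})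
    (ν : List ℕ) (hν : ν ∈ C)
    (hineq : ‖φ ν - star' f (φ ν) • f‖ ^ p.toReal + eps p φ ν <
      ‖star' f (φ ν) • f‖ ^ p.toReal) :
    IsSubvecGLB (star' f (φ ν) • f) (φ '' C) := by
  obtain ⟨n, hn⟩ := hfatom
  have hf0 : ∀ m, m ≠ n → f m = 0 := fun m hm => by
    by_contra h
    have : m ∈ {m : ℕ | f m ≠ 0} := h
    rw [hn] at this
    exact hm this
  have hfs : f = lp.single p n (f n) := by
    ext m
    by_cases hm : m = n
    · subst hm; rw [lp.single_apply_self]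
    · rw [lp.single_apply_ne _ _ _ hm, hf0 m hm]
  have hfn : ‖f n‖ = 1 := by
    rw [← hfnorm]
    conv_rhs => rw [hfs]
    rw [lp.norm_single (zero_lt_one.trans_le (Fact.out : 1 ≤ p))]
  have hst : star' f (φ ν) = φ ν n * starRingEnd ℂ (f n) := by
    unfold star'
    apply tsum_eq_single
    intro m hm
    simp [hf0 m hm]
  set v := star' f (φ ν) • f with hvdef
  have hv : ∀ m, m ≠ n → v m = 0 := fun m hm => by
    rw [hvdef, lp.coeFn_smul, Pi.smul_apply, hf0 m hm, smul_zero]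
  have hvn : v n = φ ν n := by
    rw [hvdef, lp.coeFn_smul, Pi.smul_apply, hst, smul_eq_mul, mul_assoc, Complex.conj_mul', hfn]
    simp
  have heps : 0 ≤ eps p φ ν := by unfold eps; positivity
  have hv0 : v n ≠ 0 := by
    intro h
    have hz : v = 0 := by
      ext m
      by_cases hm : m = n
      · subst hm; simpa using h
      · simpa using hv m hm
    rw [hz, sub_zero] at hineq
    have : ‖(0 : ellp p)‖ ^ p.toReal ≤ ‖φ ν‖ ^ p.toReal :=
      Real.rpow_le_rpow (norm_nonneg _) (by simp) ENNReal.toReal_nonneg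
    linarith
  have hall : ∀ τ ∈ C, φ τ n = v n := by
    intro τ hτ
    rcases hC.2.1 ν hν τ hτ with h | h
    · exact key_step hptop hφ hC v n hv hv0 (τ.length - ν.length) ν hν hvn.symm hineq τ hτ h
        (by have := h.length_le; omega)
    · rw [hvn] at hv0 ⊢
      exact anc_eval hφ n h (hC.1 hν) hv0
  refine ⟨?_, ?_⟩
  · rintro _ ⟨τ, hτ, rfl⟩
    refine ⟨{n}, ?_⟩
    funext m
    by_cases hm : m = n
    · subst hm; simp [hall τ hτ]
    · simp [hv m hm, hm]
  · intro g hg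
    have hgv : ∀ m, ∀ τ ∈ C, g m ≠ 0 → φ τ m = g m := by
      intro m τ hτ h
      obtain ⟨A, hA⟩ := hg _ ⟨τ, hτ, rfl⟩
      rw [hA] at h ⊢
      by_cases hm : m ∈ A
      · simp [hm]
      · simp [hm] at h
    have hg0 : ∀ m, m ≠ n → g m = 0 := by
      intro m hm
      by_contra h
      exact no_two hφ hC ⟨ν, hν⟩ m n hm (v n) (g m) hv0 h hall (fun σ hσ => hgv m σ hσ h)
    refine ⟨{m | g m ≠ 0}, ?_⟩
    funext m
    by_cases h : g m = 0
    · simp [h]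
    · have hm : m = n := by
        by_contra hm
        exact h (hg0 m hm)
      subst hm
      rw [Set.indicator_of_mem (by exact h), ← hall ν hν, hgv m ν hν h]
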